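/- Let K ⊆ ℝⁿ be a convex body with barycenter at the origin, i.e. b(K) = (1/vol(K)) ∫_K x dx = 0. Then vol(K ∩ -K) ≥ 2^{-n} vol(K). -/

import Mathlib

open Set MeasureTheory

section

open scoped ENNReal Pointwise Convolution

/-- One-dimensional Brunn–Minkowski inequality for nonempty compact sets. -/
theorem Real.volume_add_le_volume_add {A B : Set ℝ} (hA : IsCompact A) (hB : IsCompact B)
    (hA' : A.Nonempty) (hB' : B.Nonempty) : volume A + volume B ≤ volume (A + B) := by
  have hAα : sSup A ∈ A := hA.sSup_mem hA'
  have hBβ : sInf B ∈ B := hB.sInf_mem hB'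
  have hdisj : AEDisjoint volume (sInf B +ᵥ A) (sSup A +ᵥ B) := by
    refine measure_mono_null (t := {sSup A + sInf B}) ?_ (by simp)
    rintro _ ⟨⟨x, hx, rfl⟩, ⟨y, hy, hxy⟩⟩
    have h1 := le_csSup hA.bddAbove hx
    have h2 := csInf_le hB.bddBelow hy
    simp only [vadd_eq_add, mem_singleton_iff] at *
    linarith
  have hunion := measure_union₀ (μ := volume) (s := sInf B +ᵥ A)
    (hB.vadd (sSup A)).measurableSet.nullMeasurableSet hdisj
  rw [measure_vadd, measure_vadd] at hunion
  rw [← hunion]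
  refine measure_mono (union_subset ?_ ?_)
  · rintro _ ⟨x, hx, rfl⟩
    exact ⟨x, hx, _, hBβ, by simp [add_comm]⟩
  · rintro _ ⟨x, hx, rfl⟩
    exact ⟨_, hAα, x, hx, by simp⟩

/-- Weighted one-dimensional Brunn–Minkowski inequality for nonempty measurable sets. -/
theorem Real.volume_weighted_add_le {A B C : Set ℝ} {a b : ℝ} (ha : 0 ≤ a) (hb : 0 ≤ b)
    (hA : MeasurableSet A) (hB : MeasurableSet B) (hA' : A.Nonempty) (hB' : B.Nonempty)
    (hC : ∀ x ∈ A, ∀ y ∈ B, a * x + b * y ∈ C) :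
    ENNReal.ofReal a * volume A + ENNReal.ofReal b * volume B ≤ volume C := by
  obtain ⟨x₀, hx₀⟩ := hA'
  obtain ⟨y₀, hy₀⟩ := hB'
  have hcompact {S T : Set ℝ} (hS : IsCompact S) (hT : IsCompact T) (hSA : S ⊆ A) (hTB : T ⊆ B) :
      ENNReal.ofReal a * volume S + ENNReal.ofReal b * volume T ≤ volume C := by
    have h := Real.volume_add_le_volume_add ((hS.insert x₀).smul a) ((hT.insert y₀).smul b)
      ((insert_nonempty _ _).smul_set) ((insert_nonempty _ _).smul_set)
    simp only [Measure.addHaar_smul, Module.finrank_self, pow_one, abs_of_nonneg ha,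
      abs_of_nonneg hb] at h
    refine le_trans ?_ (h.trans (measure_mono ?_))
    · gcongr <;> exact subset_insert _ _
    · rintro _ ⟨_, ⟨x, hx, rfl⟩, _, ⟨y, hy, rfl⟩, rfl⟩
      exact hC x (insert_subset hx₀ hSA hx) y (insert_subset hy₀ hTB hy)
  rw [hA.measure_eq_iSup_isCompact, hB.measure_eq_iSup_isCompact]
  simp only [iSup_and']
  simp only [iSup_subtype', ENNReal.mul_iSup]
  have : Nonempty {i : Set ℝ // i ⊆ A ∧ IsCompact i} := ⟨⟨∅, by simp⟩⟩
  have : Nonempty {i : Set ℝ // i ⊆ B ∧ IsCompact i} := ⟨⟨∅, by simp⟩⟩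
  exact ENNReal.iSup_add_iSup_le fun S T => hcompact S.2.2 T.2.2 S.2.1 T.2.1

/-- Layer cake formula for functions bounded by one. -/
theorem lintegral_eq_setLIntegral_Ioo_measure_lt {α : Type*} [MeasurableSpace α] {μ : Measure α}
    {f : α → ℝ≥0∞} (hf : Measurable f) (hf1 : ∀ x, f x ≤ 1) :
    ∫⁻ x, f x ∂μ = ∫⁻ t in Ioo (0 : ℝ) 1, μ {x | ENNReal.ofReal t < f x} := by
  have htop x : f x ≠ ∞ := ((hf1 x).trans_lt ENNReal.one_lt_top).ne
  have h := lintegral_eq_lintegral_meas_lt (f := fun x => (f x).toReal) μ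
    (ae_of_all _ fun x => ENNReal.toReal_nonneg) hf.ennreal_toReal.aemeasurable
  simp only [ENNReal.ofReal_toReal (htop _)] at h
  rw [h, ← Ioo_union_Ici_eq_Ioi one_pos,
    lintegral_union measurableSet_Ici (by
      rw [Set.disjoint_left]; intro x hx hx'; exact absurd hx.2 (not_lt.2 hx'))]
  have hzero : ∫⁻ t in Ici (1 : ℝ), μ {x | t < (f x).toReal} = 0 := by
    rw [setLIntegral_congr_fun (g := fun _ => 0) measurableSet_Ici, lintegral_zero]
    intro t ht
    have : {x | t < (f x).toReal} = ∅ := by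
      ext x
      have := ENNReal.toReal_mono ENNReal.one_ne_top (hf1 x)
      simp only [ENNReal.toReal_one, mem_Ici] at this ht
      simpa using this.trans ht
    simp [this]
  rw [hzero, add_zero]
  refine setLIntegral_congr_fun measurableSet_Ioo fun t ht => ?_
  simp only [ENNReal.ofReal_lt_iff_lt_toReal ht.1.le (htop _)]

/-- Weighted inequality between the geometric and the arithmetic mean in `ℝ≥0∞`. -/
theorem ENNReal.rpow_mul_rpow_le_weighted_add {a b : ℝ} (ha : 0 < a) (hb : 0 < b)
    (hab : a + b = 1) (x y : ℝ≥0∞) :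
    x ^ a * y ^ b ≤ ENNReal.ofReal a * x + ENNReal.ofReal b * y := by
  have hpq : (a⁻¹).HolderConjugate b⁻¹ := by
    rw [Real.holderConjugate_iff]
    refine ⟨?_, by simpa using hab⟩
    exact (one_lt_inv₀ ha).2 (by linarith)
  have h := ENNReal.young_inequality (x ^ a) (y ^ b) hpq
  rw [← ENNReal.rpow_mul, ← ENNReal.rpow_mul, mul_inv_cancel₀ ha.ne', mul_inv_cancel₀ hb.ne',
    ENNReal.rpow_one, ENNReal.rpow_one, ENNReal.ofReal_inv_of_pos ha,
    ENNReal.ofReal_inv_of_pos hb, ENNReal.div_eq_inv_mul, ENNReal.div_eq_inv_mul, inv_inv,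
    inv_inv] at h
  exact h

/-- One-dimensional Prékopa–Leindler inequality for functions whose supremum is one. -/
theorem prekopa_leindler_real_of_iSup_eq_one {a b : ℝ} (ha : 0 < a) (hb : 0 < b)
    (hab : a + b = 1) {f g h : ℝ → ℝ≥0∞} (hf : Measurable f) (hg : Measurable g)
    (hh : Measurable h) (hf1 : ⨆ x, f x = 1) (hg1 : ⨆ x, g x = 1)
    (hle : ∀ x y, f x ^ a * g y ^ b ≤ h (a * x + b * y)) :
    (∫⁻ x, f x) ^ a * (∫⁻ x, g x) ^ b ≤ ∫⁻ x, h x := by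
  have hf1' x : f x ≤ 1 := hf1 ▸ le_iSup f x
  have hg1' x : g x ≤ 1 := hg1 ▸ le_iSup g x
  refine (ENNReal.rpow_mul_rpow_le_weighted_add ha hb hab _ _).trans ?_
  refine le_trans ?_ (lintegral_mono fun x => min_le_left (h x) 1)
  rw [lintegral_eq_setLIntegral_Ioo_measure_lt hf hf1',
    lintegral_eq_setLIntegral_Ioo_measure_lt hg hg1',
    lintegral_eq_setLIntegral_Ioo_measure_lt (hh.min measurable_const) fun x => min_le_right _ _,
    ← lintegral_const_mul' _ _ ENNReal.ofReal_ne_top,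
    ← lintegral_const_mul' _ _ ENNReal.ofReal_ne_top, ← lintegral_add_left]
  · refine setLIntegral_mono' measurableSet_Ioo fun t ht => ?_
    have ht1 : ENNReal.ofReal t < 1 := by simpa using ht.2
    obtain ⟨x₀, hx₀⟩ := lt_iSup_iff.1 (hf1 ▸ ht1)
    obtain ⟨y₀, hy₀⟩ := lt_iSup_iff.1 (hg1 ▸ ht1)
    refine Real.volume_weighted_add_le ha.le hb.le (measurableSet_lt measurable_const hf)
      (measurableSet_lt measurable_const hg) ⟨x₀, hx₀⟩ ⟨y₀, hy₀⟩
      fun x hx y hy => lt_min ?_ ht1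
    refine lt_of_lt_of_le ?_ (hle x y)
    calc ENNReal.ofReal t = ENNReal.ofReal t ^ a * ENNReal.ofReal t ^ b := by
          rw [← ENNReal.rpow_add_of_nonneg _ _ ha.le hb.le, hab, ENNReal.rpow_one]
      _ < f x ^ a * g y ^ b :=
          ENNReal.mul_lt_mul (ENNReal.rpow_lt_rpow hx ha) (ENNReal.rpow_lt_rpow hy hb)
  · refine Measurable.const_mul (Antitone.measurable fun s t hst => measure_mono fun x hx => ?_) _
    exact lt_of_le_of_lt (ENNReal.ofReal_le_ofReal hst) hx

/-- One-dimensional Prékopa–Leindler inequality for functions whose supremum is finite. -/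
theorem prekopa_leindler_real_of_iSup_ne_top {a b : ℝ} (ha : 0 < a) (hb : 0 < b)
    (hab : a + b = 1) {f g h : ℝ → ℝ≥0∞} (hf : Measurable f) (hg : Measurable g)
    (hh : Measurable h) (hftop : ⨆ x, f x ≠ ∞) (hgtop : ⨆ x, g x ≠ ∞)
    (hle : ∀ x y, f x ^ a * g y ^ b ≤ h (a * x + b * y)) :
    (∫⁻ x, f x) ^ a * (∫⁻ x, g x) ^ b ≤ ∫⁻ x, h x := by
  rcases eq_or_ne (⨆ x, f x) 0 with hf0 | hf0
  · simp [show ∀ x, f x = 0 by simpa using hf0, ha]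
  rcases eq_or_ne (⨆ x, g x) 0 with hg0 | hg0
  · simp [show ∀ x, g x = 0 by simpa using hg0, hb]
  set α := ⨆ x, f x
  set β := ⨆ x, g x
  have hα_inv : α⁻¹ ≠ ∞ := by simpa using hf0
  have hβ_inv : β⁻¹ ≠ ∞ := by simpa using hg0
  have key := prekopa_leindler_real_of_iSup_eq_one ha hb hab (hf.const_mul α⁻¹) (hg.const_mul β⁻¹)
    (hh.const_mul ((α⁻¹) ^ a * (β⁻¹) ^ b))
    (by rw [← ENNReal.mul_iSup]; exact ENNReal.inv_mul_cancel hf0 hftop)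
    (by rw [← ENNReal.mul_iSup]; exact ENNReal.inv_mul_cancel hg0 hgtop)
    (fun x y => by
      rw [ENNReal.mul_rpow_of_nonneg _ _ ha.le, ENNReal.mul_rpow_of_nonneg _ _ hb.le,
        mul_mul_mul_comm]
      gcongr
      exact hle x y)
  rw [lintegral_const_mul _ hf, lintegral_const_mul _ hg, lintegral_const_mul _ hh,
    ENNReal.mul_rpow_of_nonneg _ _ ha.le, ENNReal.mul_rpow_of_nonneg _ _ hb.le,
    mul_mul_mul_comm] at key
  refine (ENNReal.mul_le_mul_iff_right ?_ ?_).1 key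
  · exact mul_ne_zero (by simp [ENNReal.rpow_eq_zero_iff, ha, hftop, hf0])
      (by simp [ENNReal.rpow_eq_zero_iff, hb, hgtop, hg0])
  · exact ENNReal.mul_ne_top (ENNReal.rpow_ne_top_of_nonneg ha.le hα_inv)
      (ENNReal.rpow_ne_top_of_nonneg hb.le hβ_inv)

/-- One-dimensional Prékopa–Leindler inequality. -/
theorem prekopa_leindler_real {a b : ℝ} (ha : 0 < a) (hb : 0 < b)
    (hab : a + b = 1) {f g h : ℝ → ℝ≥0∞} (hf : Measurable f) (hg : Measurable g)
    (hh : Measurable h) (hle : ∀ x y, f x ^ a * g y ^ b ≤ h (a * x + b * y)) :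
    (∫⁻ x, f x) ^ a * (∫⁻ x, g x) ^ b ≤ ∫⁻ x, h x := by
  rcases eq_or_ne (∫⁻ x, f x) 0 with hf0 | hf0
  · simp [hf0, ha]
  rcases eq_or_ne (∫⁻ x, g x) 0 with hg0 | hg0
  · simp [hg0, hb]
  have htrunc {u : ℝ → ℝ≥0∞} (hu : Measurable u) :
      Filter.Tendsto (fun k : ℕ => ∫⁻ x, min (u x) k) Filter.atTop (nhds (∫⁻ x, u x)) := by
    refine lintegral_tendsto_of_tendsto_of_monotone
      (fun k => (hu.min measurable_const).aemeasurable)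
      (ae_of_all _ fun x k l hkl => min_le_min_left _ (by exact_mod_cast hkl))
      (ae_of_all _ fun x => ?_)
    simpa using (tendsto_const_nhds (x := u x)).min ENNReal.tendsto_nat_nhds_top
  have htop (u : ℝ → ℝ≥0∞) (k : ℕ) : ⨆ x, min (u x) k ≠ ∞ :=
    ((iSup_le fun x => min_le_right _ _).trans_lt (ENNReal.natCast_lt_top k)).ne
  refine le_of_tendsto' (ENNReal.Tendsto.mul ((htrunc hf).ennrpow_const a) (Or.inl ?_)
    ((htrunc hg).ennrpow_const b) (Or.inl ?_)) fun k =>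
      prekopa_leindler_real_of_iSup_ne_top ha hb hab (hf.min measurable_const)
        (hg.min measurable_const) hh (htop f k) (htop g k) fun x y => le_trans ?_ (hle x y)
  · simp [ENNReal.rpow_eq_zero_iff, hf0, ha.le]
  · simp [ENNReal.rpow_eq_zero_iff, hg0, hb.le]
  · gcongr <;> exact min_le_left _ _

/-- **Prékopa–Leindler inequality** in `ℝⁿ`. -/
theorem prekopa_leindler {a b : ℝ} (ha : 0 < a) (hb : 0 < b) (hab : a + b = 1) {n : ℕ}
    {f g h : (Fin n → ℝ) → ℝ≥0∞} (hf : Measurable f) (hg : Measurable g) (hh : Measurable h)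
    (hle : ∀ x y, f x ^ a * g y ^ b ≤ h (a • x + b • y)) :
    (∫⁻ x, f x) ^ a * (∫⁻ x, g x) ^ b ≤ ∫⁻ x, h x := by
  induction n with
  | zero =>
    have hdef : a • default + b • default = (default : Fin 0 → ℝ) := Subsingleton.elim _ _
    have h := hle default default
    rw [hdef] at h
    simp only [lintegral_unique, volume_pi, Measure.pi_empty_univ, mul_one]
    convert h
  | succ n ih =>
    let e := (MeasurableEquiv.piFinSuccAbove (fun _ : Fin (n + 1) => ℝ) 0).symm
    have he : MeasurePreserving e :=
      (volume_preserving_piFinSuccAbove (fun _ : Fin (n + 1) => ℝ) 0).symm _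
    have hfub {u : (Fin (n + 1) → ℝ) → ℝ≥0∞} (hu : Measurable u) :
        ∫⁻ x, u x = ∫⁻ s, ∫⁻ z, u (e (s, z)) := by
      rw [← he.lintegral_comp hu, Measure.volume_eq_prod, lintegral_prod _ (by fun_prop)]
    have hmeas {u : (Fin (n + 1) → ℝ) → ℝ≥0∞} (hu : Measurable u) :
        Measurable fun s => ∫⁻ z, u (e (s, z)) :=
      (hu.comp e.measurable).lintegral_prod_right'
    have hlin (s t : ℝ) (z w : Fin n → ℝ) :
        e (a * s + b * t, a • z + b • w) = a • e (s, z) + b • e (t, w) := by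
      ext i
      refine Fin.cases ?_ (fun j => ?_) i <;> simp [e]
    rw [hfub hf, hfub hg, hfub hh]
    refine prekopa_leindler_real ha hb hab (hmeas hf) (hmeas hg) (hmeas hh) fun s t => ?_
    refine ih (by fun_prop) (by fun_prop) (by fun_prop) fun z w => ?_
    rw [hlin]
    exact hle _ _

/-- Multiplicative **Brunn–Minkowski inequality**. -/
theorem volume_rpow_mul_volume_rpow_le {a b : ℝ} (ha : 0 < a) (hb : 0 < b) (hab : a + b = 1)
    {n : ℕ} {A B C : Set (Fin n → ℝ)} (hA : MeasurableSet A) (hB : MeasurableSet B)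
    (hC : MeasurableSet C) (hABC : ∀ x ∈ A, ∀ y ∈ B, a • x + b • y ∈ C) :
    volume A ^ a * volume B ^ b ≤ volume C := by
  have h := prekopa_leindler ha hb hab (f := A.indicator 1) (g := B.indicator 1)
    (h := C.indicator 1) (measurable_one.indicator hA) (measurable_one.indicator hB)
    (measurable_one.indicator hC) fun x y => by
      by_cases hx : x ∈ A
      · by_cases hy : y ∈ B
        · simp [hx, hy, hABC x hx y hy]
        · simp [hy, hb]
      · simp [hx, ha]
  simpa [lintegral_indicator_one, hA, hB, hC] using h

/-- A concave function on an open convex set admits a supporting affine function at each point. -/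
theorem ConcaveOn.exists_le_add_continuousLinearMap {E : Type*} [NormedAddCommGroup E]
    [NormedSpace ℝ E] [FiniteDimensional ℝ E] {U : Set E} {φ : E → ℝ} (hφ : ConcaveOn ℝ U φ)
    (hU : IsOpen U) {x₀ : E} (hx₀ : x₀ ∈ U) :
    ∃ ℓ : E →L[ℝ] ℝ, ∀ x ∈ U, φ x ≤ φ x₀ + ℓ (x - x₀) := by
  have hopen : IsOpen {p : E × ℝ | p.1 ∈ U ∧ p.2 < φ p.1} := by
    have hcont : ContinuousOn (fun p : E × ℝ => φ p.1 - p.2) (Prod.fst ⁻¹' U) :=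
      ((hφ.continuousOn hU).comp continuousOn_fst fun p hp => hp).sub continuousOn_snd
    have h := hcont.isOpen_inter_preimage (hU.preimage continuous_fst) (isOpen_Ioi (a := (0 : ℝ)))
    convert h using 1
    ext p
    simp
  obtain ⟨L, hL⟩ := geometric_hahn_banach_open_point (x := (x₀, φ x₀))
    hφ.convex_strict_hypograph hopen (by simp)
  have hsplit (x : E) (t : ℝ) : L (x, t) = L (x, 0) + t * L (0, 1) := by
    rw [← smul_eq_mul, ← map_smul, ← map_add]
    simp
  have hc : 0 < L (0, 1) := by
    have h := hL (x₀, φ x₀ - 1) ⟨hx₀, by simp⟩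
    rw [hsplit x₀ (φ x₀ - 1), hsplit x₀ (φ x₀)] at h
    linarith
  refine ⟨-(L (0, 1))⁻¹ • L.comp (.inl ℝ E ℝ), fun x hx => le_of_forall_lt fun t ht => ?_⟩
  have h := hL (x, t) ⟨hx, ht⟩
  rw [hsplit x t, hsplit x₀ (φ x₀)] at h
  have hsub : L (x - x₀, 0) = L (x, 0) - L (x₀, 0) := by
    rw [← map_sub]
    simp
  have hval : φ x₀ + (-(L (0, 1))⁻¹ • L.comp (.inl ℝ E ℝ)) (x - x₀)
      = (φ x₀ * L (0, 1) - (L (x, 0) - L (x₀, 0))) / L (0, 1) := by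
    simp only [smul_apply, ContinuousLinearMap.comp_apply,
      ContinuousLinearMap.inl_apply, hsub, smul_eq_mul]
    field_simp
    ring
  rw [hval, lt_div_iff₀ hc]
  linarith

section Barycenter

variable {E : Type*} [NormedAddCommGroup E] [NormedSpace ℝ E] [FiniteDimensional ℝ E]
  [MeasurableSpace E] [BorelSpace E] {μ : Measure E} [μ.IsAddHaarMeasure]

/-- Linear functionals have integral zero over a compact set with barycenter at the origin. -/
theorem IsCompact.setIntegral_continuousLinearMap_eq_zero {K : Set E} (hK : IsCompact K)
    (hbary : ∫ x in K, x ∂μ = 0) (ℓ : E →L[ℝ] ℝ) : ∫ x in K, ℓ x ∂μ = 0 := by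
  have hid : IntegrableOn (fun x : E => x) K μ :=
    continuous_id.continuousOn.integrableOn_compact hK
  rw [ℓ.integral_comp_comm hid, hbary, map_zero]

/-- The barycenter of a convex body is an interior point. -/
theorem Convex.zero_mem_interior_of_setIntegral_eq_zero {K : Set E} (hconv : Convex ℝ K)
    (hcomp : IsCompact K) (hint : (interior K).Nonempty) (hbary : ∫ x in K, x ∂μ = 0) :
    (0 : E) ∈ interior K := by
  by_contra h0
  obtain ⟨ℓ, hℓ⟩ := geometric_hahn_banach_open_point hconv.interior isOpen_interior h0
  simp only [map_zero] at hℓ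
  have hle : ∀ x ∈ K, ℓ x ≤ 0 := by
    intro x hx
    have hx' : x ∈ closure (interior K) := by
      rw [hconv.closure_interior_eq_closure_of_nonempty_interior hint]
      exact subset_closure hx
    exact closure_minimal (fun y hy => (hℓ y hy).le) (isClosed_le ℓ.continuous continuous_const) hx'
  have hae : ∀ᵐ x ∂μ.restrict K, (-ℓ) x = 0 := by
    refine (setIntegral_eq_zero_iff_of_nonneg_ae ?_ ?_).1 ?_
    · exact (ae_restrict_iff' hcomp.measurableSet).2
        (ae_of_all _ fun x hx => by simpa using hle x hx)
    · exact (-ℓ).continuous.continuousOn.integrableOn_compact hcomp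
    · exact hcomp.setIntegral_continuousLinearMap_eq_zero hbary (-ℓ)
  have hnull : μ (interior K) = 0 := by
    rw [ae_restrict_iff' hcomp.measurableSet] at hae
    refine measure_mono_null (fun x hx => ?_) hae
    have h1 := hℓ x hx
    simpa [interior_subset hx] using h1.ne
  exact (isOpen_interior.measure_pos μ hint).ne' hnull

end Barycenter

/-- The set of decompositions `x = t + (x - t)` into two elements of `K`; its volume is the value
at `x` of the convolution square of the indicator function of `K`. -/
def decompositionSet {E : Type*} [AddGroup E] (K : Set E) (x : E) : Set E :=
  {t | t ∈ K ∧ x - t ∈ K}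

theorem isCompact_decompositionSet {E : Type*} [AddGroup E] [TopologicalSpace E]
    [IsTopologicalAddGroup E] [T2Space E] {K : Set E} (hK : IsCompact K) (x : E) :
    IsCompact (decompositionSet K x) :=
  hK.inter_right (hK.isClosed.preimage (continuous_const.sub continuous_id))

theorem decompositionSet_eq_empty {E : Type*} [AddCommGroup E] [Module ℝ E] {K : Set E}
    (hK : Convex ℝ K) {x : E} (hx : x ∉ (2 : ℝ) • K) : decompositionSet K x = ∅ := by
  refine eq_empty_of_forall_notMem fun t ht => hx ?_
  refine ⟨(1 / 2 : ℝ) • t + (1 / 2 : ℝ) • (x - t),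
    hK ht.1 ht.2 (by norm_num) (by norm_num) (by norm_num), ?_⟩
  simp only
  module

theorem convolution_indicator_one_eq_measureReal {E : Type*} [NormedAddCommGroup E]
    [MeasurableSpace E] [BorelSpace E] {μ : Measure E} {K : Set E} (hK : IsCompact K) (x : E) :
    (K.indicator (1 : E → ℝ) ⋆[ContinuousLinearMap.mul ℝ ℝ, μ] K.indicator (1 : E → ℝ)) x
      = μ.real (decompositionSet K x) := by
  rw [convolution_def, ← integral_indicator_one (isCompact_decompositionSet hK x).measurableSet]
  congr 1 with t
  by_cases h1 : t ∈ K <;> by_cases h2 : x - t ∈ K <;> simp [decompositionSet, h1, h2]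

theorem measureReal_decompositionSet_pos {E : Type*} [NormedAddCommGroup E]
    [NormedSpace ℝ E] [MeasurableSpace E] {μ : Measure E} [μ.IsAddHaarMeasure] {K : Set E}
    (hK : IsCompact K) {x : E}
    (hx : x ∈ interior ((2 : ℝ) • K)) : 0 < μ.real (decompositionSet K x) := by
  rw [interior_smul₀ two_ne_zero] at hx
  obtain ⟨y, hy, rfl⟩ := hx
  refine ENNReal.toReal_pos (ne_of_gt ?_) (isCompact_decompositionSet hK _).measure_lt_top.ne
  have hopen : IsOpen (interior K ∩ (fun t => (2 : ℝ) • y - t) ⁻¹' interior K) :=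
    isOpen_interior.inter (isOpen_interior.preimage (continuous_const.sub continuous_id))
  refine (hopen.measure_pos μ ⟨y, hy, ?_⟩).trans_le (measure_mono fun t ht => ?_)
  · simpa [two_smul] using hy
  · exact ⟨interior_subset ht.1, interior_subset ht.2⟩

section Convolution

variable {E : Type*} [NormedAddCommGroup E] [NormedSpace ℝ E] [FiniteDimensional ℝ E]
  [MeasurableSpace E] [BorelSpace E] {μ : Measure E} [μ.IsAddHaarMeasure]

/-- The measure of the decomposition sets is an integrable function with integral the square of
the measure of `K`. -/
theorem IsCompact.integral_measureReal_decompositionSet {K : Set E} (hK : IsCompact K) :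
    Integrable (fun x => μ.real (decompositionSet K x)) μ ∧
      ∫ x, μ.real (decompositionSet K x) ∂μ = μ.real K * μ.real K := by
  have hk : Integrable (K.indicator (1 : E → ℝ)) μ :=
    (integrable_indicator_iff hK.measurableSet).2
      (continuous_one.continuousOn.integrableOn_compact hK)
  simp only [← convolution_indicator_one_eq_measureReal hK]
  refine ⟨hk.integrable_convolution _ hk, ?_⟩
  rw [integral_convolution _ hk hk, integral_indicator_one hK.measurableSet]
  rfl

/-- If `K` has its barycenter at the origin, then so has the convolution square of its indicator
function. -/
theorem IsCompact.integral_measureReal_decompositionSet_mul {K : Set E} (hK : IsCompact K)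
    (hbary : ∫ x in K, x ∂μ = 0) (ℓ : E →L[ℝ] ℝ) :
    Integrable (fun x => μ.real (decompositionSet K x) * ℓ x) μ ∧
      ∫ x, μ.real (decompositionSet K x) * ℓ x ∂μ = 0 := by
  have hk : Integrable (K.indicator (1 : E → ℝ)) μ :=
    (integrable_indicator_iff hK.measurableSet).2
      (continuous_one.continuousOn.integrableOn_compact hK)
  have hkℓ : Integrable (K.indicator ℓ) μ :=
    (integrable_indicator_iff hK.measurableSet).2
      (ℓ.continuous.continuousOn.integrableOn_compact hK)
  have hsplit : (fun x => μ.real (decompositionSet K x) * ℓ x)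
      = (K.indicator ℓ ⋆[ContinuousLinearMap.mul ℝ ℝ, μ] K.indicator (1 : E → ℝ))
        + (K.indicator (1 : E → ℝ) ⋆[ContinuousLinearMap.mul ℝ ℝ, μ] K.indicator ℓ) := by
    ext x
    have hS := (isCompact_decompositionSet hK x).measurableSet
    have hfirst : (K.indicator ℓ ⋆[ContinuousLinearMap.mul ℝ ℝ, μ] K.indicator (1 : E → ℝ)) x
        = ∫ t in decompositionSet K x, ℓ t ∂μ := by
      rw [convolution_def, ← integral_indicator hS]
      congr 1 with t
      by_cases h1 : t ∈ K <;> by_cases h2 : x - t ∈ K <;> simp [decompositionSet, h1, h2]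
    have hsecond : (K.indicator (1 : E → ℝ) ⋆[ContinuousLinearMap.mul ℝ ℝ, μ] K.indicator ℓ) x
        = ∫ t in decompositionSet K x, ℓ (x - t) ∂μ := by
      rw [convolution_def, ← integral_indicator hS]
      congr 1 with t
      by_cases h1 : t ∈ K <;> by_cases h2 : x - t ∈ K <;> simp [decompositionSet, h1, h2]
    rw [Pi.add_apply, hfirst, hsecond, ← integral_add]
    · simp
    · exact ℓ.continuous.continuousOn.integrableOn_compact (isCompact_decompositionSet hK x)
    · exact (ℓ.continuous.comp (continuous_sub_left x)).continuousOn.integrableOn_compact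
        (isCompact_decompositionSet hK x)
  have hzero : ∫ x, K.indicator ℓ x ∂μ = 0 := by
    rw [integral_indicator hK.measurableSet, hK.setIntegral_continuousLinearMap_eq_zero hbary]
  have hint₁ := hkℓ.integrable_convolution (ContinuousLinearMap.mul ℝ ℝ) hk
  have hint₂ := hk.integrable_convolution (ContinuousLinearMap.mul ℝ ℝ) hkℓ
  rw [hsplit]
  refine ⟨hint₁.add hint₂, ?_⟩
  rw [integral_add' hint₁ hint₂, integral_convolution _ hkℓ hk, integral_convolution _ hk hkℓ,
    hzero]
  simp

end Convolution

/-- The convolution square of the indicator function of a convex body is log-concave. -/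
theorem concaveOn_log_volumeReal_decompositionSet {n : ℕ} {K : Set (Fin n → ℝ)}
    (hconv : Convex ℝ K) (hcomp : IsCompact K) :
    ConcaveOn ℝ (interior ((2 : ℝ) • K))
      fun x => Real.log (volume.real (decompositionSet K x)) := by
  refine concaveOn_iff_forall_pos.2 ⟨(hconv.smul 2).interior, fun x hx y hy a b ha hb hab => ?_⟩
  have hxpos := measureReal_decompositionSet_pos (μ := volume) hcomp hx
  have hypos := measureReal_decompositionSet_pos (μ := volume) hcomp hy
  have hBM := volume_rpow_mul_volume_rpow_le ha hb hab
    (isCompact_decompositionSet hcomp x).measurableSet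
    (isCompact_decompositionSet hcomp y).measurableSet
    (isCompact_decompositionSet hcomp (a • x + b • y)).measurableSet (by
      intro s hs t ht
      refine ⟨hconv hs.1 ht.1 ha.le hb.le hab, ?_⟩
      have h := hconv hs.2 ht.2 ha.le hb.le hab
      convert h using 1
      module)
  have hBM_real := ENNReal.toReal_mono
    (isCompact_decompositionSet hcomp (a • x + b • y)).measure_lt_top.ne hBM
  rw [ENNReal.toReal_mul, ← ENNReal.toReal_rpow, ← ENNReal.toReal_rpow] at hBM_real
  have hxa := Real.rpow_pos_of_pos hxpos a
  have hyb := Real.rpow_pos_of_pos hypos b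
  simp only [smul_eq_mul]
  rw [← Real.log_rpow hxpos, ← Real.log_rpow hypos, ← Real.log_mul hxa.ne' hyb.ne']
  exact Real.log_le_log (mul_pos hxa hyb) hBM_real

/-- If a convex body `K ⊆ ℝⁿ` has barycenter at the origin, then the value at the origin of the
convolution square of its indicator function is at least `2⁻ⁿ vol(K)`. -/
theorem volume_le_two_pow_mul_volume_decompositionSet_zero {n : ℕ} {K : Set (Fin n → ℝ)}
    (hconv : Convex ℝ K) (hcomp : IsCompact K) (hint : (interior K).Nonempty)
    (hbary : ∫ x in K, x ∂volume = 0) :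
    volume K ≤ 2 ^ n * volume (decompositionSet K 0) := by
  set F : (Fin n → ℝ) → ℝ := fun x => volume.real (decompositionSet K x) with hF
  set M : ℝ := volume.real K with hM
  set c : ℝ := M / 2 ^ n with hc
  have hMpos : 0 < M := ENNReal.toReal_pos
    ((isOpen_interior.measure_pos volume hint).trans_le (measure_mono interior_subset)).ne'
    hcomp.measure_lt_top.ne
  have hcpos : 0 < c := by positivity
  have hdouble : IsCompact ((2 : ℝ) • K) := hcomp.smul 2
  have h0 : (0 : Fin n → ℝ) ∈ interior ((2 : ℝ) • K) := by
    rw [interior_smul₀ two_ne_zero]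
    exact ⟨0, hconv.zero_mem_interior_of_setIntegral_eq_zero hcomp hint hbary, by simp⟩
  have hF0 : 0 < F 0 := measureReal_decompositionSet_pos hcomp h0
  obtain ⟨ℓ, hℓ⟩ := (concaveOn_log_volumeReal_decompositionSet hconv hcomp
    ).exists_le_add_continuousLinearMap isOpen_interior h0
  have hvol : volume.real ((2 : ℝ) • K) = 2 ^ n * M := by
    simp [measureReal_def, Measure.addHaar_smul, hM]
  have hpoint : ∀ᵐ x, ((2 : ℝ) • K).indicator (fun _ => -c) x
      ≤ (Real.log (F 0 / c) - 1) * F x + F x * ℓ x := by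
    have hfront : ∀ᵐ x, x ∉ frontier ((2 : ℝ) • K) :=
      measure_eq_zero_iff_ae_notMem.1 ((hconv.smul 2).addHaar_frontier volume)
    filter_upwards [hfront] with x hx
    by_cases hxK : x ∈ (2 : ℝ) • K
    · have hxint : x ∈ interior ((2 : ℝ) • K) := by
        by_contra hxint
        exact hx ⟨subset_closure hxK, hxint⟩
      have hFx : 0 < F x := measureReal_decompositionSet_pos hcomp hxint
      have hsupp := hℓ x hxint
      rw [sub_zero] at hsupp
      have hlog := Real.log_le_sub_one_of_pos (div_pos hcpos hFx)
      rw [Real.log_div hcpos.ne' hFx.ne'] at hlog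
      rw [indicator_of_mem hxK, Real.log_div hF0.ne' hcpos.ne']
      have hcancel : F x * (c / F x) = c := by field_simp
      have hsum : 0 ≤ F x * (Real.log (F 0) + ℓ x - Real.log c - 1 + c / F x) :=
        mul_nonneg hFx.le (by simp only [hF] at hlog ⊢; linarith)
      linarith
    · have hFx : F x = 0 := by simp [hF, decompositionSet_eq_empty hconv hxK]
      simp [hxK, hFx]
  obtain ⟨hFint, hFval⟩ := hcomp.integral_measureReal_decompositionSet (μ := volume)
  obtain ⟨hFℓint, hFℓval⟩ := hcomp.integral_measureReal_decompositionSet_mul hbary ℓ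
  have hintegral := integral_mono_ae
    ((integrable_indicator_iff hdouble.measurableSet).2
      ((continuous_const (y := -c)).continuousOn.integrableOn_compact hdouble))
    ((hFint.const_mul _).add hFℓint) hpoint
  rw [integral_indicator hdouble.measurableSet, setIntegral_const, hvol,
    integral_add' (hFint.const_mul _) hFℓint, hFℓval, integral_const_mul, hFval,
    smul_eq_mul] at hintegral
  have hcM : 2 ^ n * M * -c = -(M * M) := by
    rw [hc]
    field_simp
  have hlog : 0 ≤ Real.log (F 0 / c) := by
    rw [hcM] at hintegral
    have : 0 ≤ Real.log (F 0 / c) * (M * M) := by linarith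
    exact nonneg_of_mul_nonneg_left this (by positivity)
  have hcF : c ≤ F 0 := by
    have h := (Real.log_nonneg_iff (div_pos hF0 hcpos)).1 hlog
    exact (one_le_div hcpos).1 h
  have hreal : M ≤ 2 ^ n * F 0 := by
    rwa [hc, div_le_iff₀' (by positivity)] at hcF
  have hfin : volume (decompositionSet K 0) ≠ ∞ :=
    (isCompact_decompositionSet hcomp 0).measure_lt_top.ne
  rw [← ENNReal.toReal_le_toReal hcomp.measure_lt_top.ne (by finiteness), ENNReal.toReal_mul]
  simpa [hM, hF, measureReal_def] using hreal

end

/-- Milman–Pajor: if a convex body `K ⊆ ℝⁿ` has barycenter at the origin, then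
`vol(K ∩ -K) ≥ 2⁻ⁿ vol(K)`. -/
theorem milman_pajor (n : ℕ) (K : Set (Fin n → ℝ))
    (hconv : Convex ℝ K) (hcomp : IsCompact K) (hint : (interior K).Nonempty)
    (hbary : ∫ x in K, x ∂volume = 0) :
    volume K ≤ 2 ^ n * volume (K ∩ -K) := by
  have hzero : decompositionSet K 0 = K ∩ -K := by
    ext t
    simp [decompositionSet]
  rw [← hzero]
  exact volume_le_two_pow_mul_volume_decompositionSet_zero hconv hcomp hint hbary
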